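/- arXiv:2604.16206 — 3 statements merged into one kernel-verified Lean document; each statement's English description precedes it below -/
import Mathlib

section
/- Let α > 0 and let p₁,…,p_n : [0,1] → [0,∞) be probability densities (∫₀¹ p_j(u) du = 1) with p_j > 0 almost everywhere on [0,1], and define l(x) := ∫₀¹ max_{j=1,…,n} x_j p_j(u) du for x ∈ [0,∞)ⁿ. Assume the densities are max-linearly independent: whenever a, b ∈ [0,∞)ⁿ satisfy max_j a_j p_j(u) = max_j b_j p_j(u) for almost every u ∈ [0,1], then a = b. Define ρ(u,v) := 1/(1 + l(u^α)) + 1/(1 + l(v^α)) − 2/(1 + l((u ∨ v)^α)) for u, v ∈ [0,∞)ⁿ. Then for all u, v ∈ [0,∞)ⁿ, ρ(u,v) = 0 if and only if u = v. -/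
open MeasureTheory ProbabilityTheory Real

/-- The standard `α`-Fréchet cumulative distribution function. -/
noncomputable def frechetCDF (α x : ℝ) : ℝ := if 0 < x then Real.exp (-(x ^ (-α))) else 0

/-- The excursion metric `𝓔_F(Y₁,Y₂) = 2 E F(Y₁ ∨ Y₂) − E F(Y₁) − E F(Y₂)`. -/
noncomputable def excMetric {Ω : Type*} [MeasureSpace Ω] (F : ℝ → ℝ) (Y₁ Y₂ : Ω → ℝ) : ℝ :=
  2 * (∫ ω, F (max (Y₁ ω) (Y₂ ω))) - (∫ ω, F (Y₁ ω)) - (∫ ω, F (Y₂ ω))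

theorem integrable_ciSup_mul {Ω ι : Type*} [MeasurableSpace Ω] {μ : Measure Ω} [Fintype ι]
    [Nonempty ι] {p : ι → Ω → ℝ} (hp : ∀ j, Integrable (p j) μ) (x : ι → ℝ) :
    Integrable (fun ω => ⨆ j, x j * p j ω) μ := by
  have h : Integrable (Finset.univ.sup' Finset.univ_nonempty (fun j ω => x j * p j ω)) μ :=
    Finset.sup'_induction Finset.univ_nonempty (fun j ω => x j * p j ω)
      (p := fun f : Ω → ℝ => Integrable f μ) (fun _ hf _ hg => hf.sup hg)
      (fun j _ => (hp j).const_mul (x j))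
  refine h.congr (Filter.Eventually.of_forall fun ω => ?_)
  simp only [Finset.sup'_apply]
  exact Finset.sup'_univ_eq_ciSup _

theorem ciSup_mul_le_ciSup_mul {ι : Type*} [Finite ι] {x y p : ι → ℝ} (hp : ∀ j, 0 ≤ p j)
    (hxy : ∀ j, x j ≤ y j) : (⨆ j, x j * p j) ≤ ⨆ j, y j * p j :=
  ciSup_mono (Set.finite_range _).bddAbove fun j => mul_le_mul_of_nonneg_right (hxy j) (hp j)

theorem eq_and_eq_of_one_div_add_one_div_eq {x y z : ℝ} (hx : 0 ≤ x) (hy : 0 ≤ y)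
    (hxz : x ≤ z) (hyz : y ≤ z) (h : 1 / (1 + x) + 1 / (1 + y) - 2 / (1 + z) = 0) :
    x = z ∧ y = z := by
  have hxz' : 1 / (1 + z) ≤ 1 / (1 + x) := by gcongr
  have hyz' : 1 / (1 + z) ≤ 1 / (1 + y) := by gcongr
  have h2 : 2 / (1 + z) = 1 / (1 + z) + 1 / (1 + z) := by ring
  have h3 : 1 / (1 + x) = 1 / (1 + z) := by linarith
  have h4 : 1 / (1 + y) = 1 / (1 + z) := by linarith
  simp only [one_div, inv_inj] at h3 h4
  exact ⟨by linarith, by linarith⟩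

theorem stmt4 {n : ℕ} (hn : 1 ≤ n) (α : ℝ) (hα : 0 < α)
    (p : Fin n → ℝ → ℝ)
    (hp_nonneg : ∀ j u, 0 ≤ p j u)
    (hp_int : ∀ j, IntervalIntegrable (p j) volume 0 1)
    (hp_dens : ∀ j, ∫ u in (0:ℝ)..1, p j u = 1)
    (hp_pos : ∀ j, ∀ᵐ u ∂(volume.restrict (Set.Ioc (0:ℝ) 1)), 0 < p j u)
    (hp_indep : ∀ a b : Fin n → ℝ, (∀ j, 0 ≤ a j) → (∀ j, 0 ≤ b j) →
      (∀ᵐ u ∂(volume.restrict (Set.Ioc (0:ℝ) 1)),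
        (⨆ j, a j * p j u) = ⨆ j, b j * p j u) → a = b)
    (l : (Fin n → ℝ) → ℝ)
    (hl : ∀ x : Fin n → ℝ, l x = ∫ u in (0:ℝ)..1, ⨆ j, x j * p j u)
    (ρ : (Fin n → ℝ) → (Fin n → ℝ) → ℝ)
    (hρ : ∀ u v : Fin n → ℝ, ρ u v
      = 1 / (1 + l (fun j => u j ^ α)) + 1 / (1 + l (fun j => v j ^ α))
        - 2 / (1 + l (fun j => (max (u j) (v j)) ^ α)))
    (u v : Fin n → ℝ) (hu : ∀ j, 0 ≤ u j) (hv : ∀ j, 0 ≤ v j) :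
    ρ u v = 0 ↔ u = v := by
  have : Nonempty (Fin n) := ⟨⟨0, hn⟩⟩
  constructor
  · intro h
    have hp' : ∀ j, Integrable (p j) (volume.restrict (Set.Ioc (0:ℝ) 1)) := fun j =>
      (intervalIntegrable_iff_integrableOn_Ioc_of_le zero_le_one).1 (hp_int j)
    have hl' : ∀ x : Fin n → ℝ, l x = ∫ t in Set.Ioc (0:ℝ) 1, ⨆ j, x j * p j t := fun x => by
      rw [hl, intervalIntegral.integral_of_le zero_le_one]
    have hl_nonneg : ∀ x : Fin n → ℝ, (∀ j, 0 ≤ x j) → 0 ≤ l x := fun x hx => by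
      rw [hl']
      exact integral_nonneg fun t => Real.iSup_nonneg fun j => mul_nonneg (hx j) (hp_nonneg j t)
    have hl_mono : ∀ x y : Fin n → ℝ, (∀ j, x j ≤ y j) → l x ≤ l y := fun x y hxy => by
      rw [hl', hl']
      exact integral_mono (integrable_ciSup_mul hp' x) (integrable_ciSup_mul hp' y)
        fun t => ciSup_mul_le_ciSup_mul (fun j => hp_nonneg j t) hxy
    have hl_strict : ∀ x y : Fin n → ℝ, (∀ j, 0 ≤ x j) → (∀ j, x j ≤ y j) → l x = l y →
        x = y := fun x y hx hxy hlxy => by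
      rw [hl', hl'] at hlxy
      refine hp_indep x y hx (fun j => (hx j).trans (hxy j)) ?_
      exact (integral_eq_iff_of_ae_le (integrable_ciSup_mul hp' x) (integrable_ciSup_mul hp' y)
        (Filter.Eventually.of_forall fun t =>
          ciSup_mul_le_ciSup_mul (fun j => hp_nonneg j t) hxy)).1 hlxy
    have hu' : ∀ j, 0 ≤ u j ^ α := fun j => rpow_nonneg (hu j) α
    have hv' : ∀ j, 0 ≤ v j ^ α := fun j => rpow_nonneg (hv j) α
    have hum : ∀ j, u j ^ α ≤ (max (u j) (v j)) ^ α := fun j =>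
      rpow_le_rpow (hu j) (le_max_left _ _) hα.le
    have hvm : ∀ j, v j ^ α ≤ (max (u j) (v j)) ^ α := fun j =>
      rpow_le_rpow (hv j) (le_max_right _ _) hα.le
    rw [hρ] at h
    obtain ⟨h₁, h₂⟩ := eq_and_eq_of_one_div_add_one_div_eq (hl_nonneg _ hu') (hl_nonneg _ hv')
      (hl_mono _ _ hum) (hl_mono _ _ hvm) h
    have huv := (hl_strict _ _ hu' hum h₁).trans (hl_strict _ _ hv' hvm h₂).symm
    funext j
    exact (rpow_left_inj (hu j) (hv j) hα.ne').1 (congrFun huv j)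
  · rintro rfl
    rw [hρ]
    simp only [max_self]
    ring
end

section
/- Let n ≥ 1, γ > 0, and let l : [0,∞)^{n+1} → ℝ be continuous, positively homogeneous of degree 1, and satisfy max_j y_j ≤ l(y) ≤ y₀ + y₁ + … + y_n for all y = (y₀,…,y_n) ∈ [0,∞)^{n+1}. Define Ψ₁(w) := 1/(l((0,w))+1) − 2/(l((1,w))+1) + (2γ/3)·(l((0,w))−1)² / ((2·l((0,w))+1)·(l((0,w))+2)) for w ∈ [0,∞)ⁿ. Then Ψ₁ attains its minimum on [0,∞)ⁿ: there exists ŵ ∈ [0,∞)ⁿ with Ψ₁(ŵ) ≤ Ψ₁(w) for all w ∈ [0,∞)ⁿ. -/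
open MeasureTheory Real

theorem cons_nonneg {n : ℕ} {s : ℝ} {w : Fin n → ℝ} (hs : 0 ≤ s) (hw : ∀ j, 0 ≤ w j) :
    ∀ j, 0 ≤ (Fin.cons s w : Fin (n + 1) → ℝ) j := by
  intro j
  refine Fin.cases ?_ (fun i => ?_) j
  · simpa using hs
  · simpa using hw i

theorem smul_cons_real {n : ℕ} (c s : ℝ) (w : Fin n → ℝ) :
    (c • (Fin.cons s w : Fin (n + 1) → ℝ)) = Fin.cons (c * s) (c • w) := by
  ext j
  refine Fin.cases ?_ (fun i => ?_) j <;> simp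

/-- The penalty term is `γ / 3` minus an explicit nonnegative remainder. -/
theorem penalty_eq (γ : ℝ) {a : ℝ} (ha : 0 ≤ a) :
    (2 * γ / 3) * (a - 1) ^ 2 / ((2 * a + 1) * (a + 2))
      = γ / 3 - 3 * γ * a / ((2 * a + 1) * (a + 2)) := by
  have h1 : 2 * a + 1 ≠ 0 := by positivity
  have h2 : a + 2 ≠ 0 := by positivity
  field_simp
  ring

theorem penalized_lower_bound {γ a b r : ℝ} (hγ : 0 < γ) (hr : 0 ≤ r) (hra : r ≤ a)
    (hrb : r ≤ b) :
    γ / 3 - (2 + 3 * γ) / (r + 1)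
      ≤ 1 / (a + 1) - 2 / (b + 1) + (2 * γ / 3) * (a - 1) ^ 2 / ((2 * a + 1) * (a + 2)) := by
  have ha : 0 ≤ a := hr.trans hra
  rw [penalty_eq γ ha, add_div]
  have h1 : 2 / (b + 1) ≤ 2 / (r + 1) := by gcongr
  have h2 : 3 * γ * a / ((2 * a + 1) * (a + 2)) ≤ 3 * γ / (a + 1) := by
    rw [div_le_div_iff₀ (by positivity) (by positivity), mul_assoc (3 * γ)]
    exact mul_le_mul_of_nonneg_left (by nlinarith) (by positivity)
  have h3 : 3 * γ / (a + 1) ≤ 3 * γ / (r + 1) := by gcongr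
  have h4 : 0 ≤ 1 / (a + 1) := by positivity
  linarith

theorem penalized_lt_limit {γ a b : ℝ} (hγ : 0 < γ) (ha : 0 < a) (hb : 0 ≤ b)
    (hba : b < 2 * a) :
    1 / (a + 1) - 2 / (b + 1) + (2 * γ / 3) * (a - 1) ^ 2 / ((2 * a + 1) * (a + 2))
      < γ / 3 := by
  rw [penalty_eq γ ha.le]
  have h1 : 1 / (a + 1) < 2 / (b + 1) := by
    rw [div_lt_div_iff₀ (by positivity) (by positivity)]
    linarith
  have h2 : 0 ≤ 3 * γ * a / ((2 * a + 1) * (a + 2)) := by positivity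
  linarith

theorem stmt14 {n : ℕ} (hn : 1 ≤ n) (γ : ℝ) (hγ : 0 < γ)
    (l : (Fin (n + 1) → ℝ) → ℝ)
    (hcont : ContinuousOn l {y : Fin (n + 1) → ℝ | ∀ j, 0 ≤ y j})
    (hhom : ∀ c : ℝ, 0 ≤ c → ∀ y : Fin (n + 1) → ℝ, (∀ j, 0 ≤ y j) → l (c • y) = c * l y)
    (hlb : ∀ y : Fin (n + 1) → ℝ, (∀ j, 0 ≤ y j) → ∀ j, y j ≤ l y)
    (hub : ∀ y : Fin (n + 1) → ℝ, (∀ j, 0 ≤ y j) → l y ≤ ∑ j, y j)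
    (Ψ : (Fin n → ℝ) → ℝ)
    (hΨ : ∀ w : Fin n → ℝ, Ψ w
      = 1 / (l (Fin.cons 0 w) + 1) - 2 / (l (Fin.cons 1 w) + 1)
        + (2 * γ / 3) * (l (Fin.cons 0 w) - 1) ^ 2
          / ((2 * l (Fin.cons 0 w) + 1) * (l (Fin.cons 0 w) + 2))) :
    ∃ w0 : Fin n → ℝ, (∀ j, 0 ≤ w0 j)
      ∧ ∀ w : Fin n → ℝ, (∀ j, 0 ≤ w j) → Ψ w0 ≤ Ψ w := by
  have hnorm : ∀ s : ℝ, 0 ≤ s → ∀ w : Fin n → ℝ, (∀ j, 0 ≤ w j) → ‖w‖ ≤ l (Fin.cons s w) := by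
    intro s hs w hw
    have hc := hlb _ (cons_nonneg hs hw)
    refine (pi_norm_le_iff_of_nonneg ?_).2 fun i => ?_
    · exact hs.trans (by simpa using hc 0)
    · rw [Real.norm_of_nonneg (hw i)]
      simpa using hc i.succ
  have hpos : ∀ s : ℝ, 0 ≤ s → ∀ w ∈ {w : Fin n → ℝ | ∀ j, 0 ≤ w j}, 0 ≤ l (Fin.cons s w) :=
    fun s hs w hw => (norm_nonneg w).trans (hnorm s hs w hw)
  have hcons : Continuous fun p : ℝ × (Fin n → ℝ) => (Fin.cons p.1 p.2 : Fin (n + 1) → ℝ) := by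
    refine continuous_pi fun j => ?_
    refine Fin.cases ?_ (fun i => ?_) j
    · simpa using continuous_fst
    · simp only [Fin.cons_succ]
      fun_prop
  have hlw : ∀ s : ℝ, 0 ≤ s →
      ContinuousOn (fun w : Fin n → ℝ => l (Fin.cons s w)) {w | ∀ j, 0 ≤ w j} := fun s hs =>
    hcont.comp (hcons.comp (Continuous.prodMk_right s)).continuousOn
      fun w hw => cons_nonneg hs hw
  have hΨc : ContinuousOn Ψ {w | ∀ j, 0 ≤ w j} := by
    rw [funext hΨ]
    have h0 := hlw 0 le_rfl
    have h1 := hlw 1 zero_le_one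
    have p0 := hpos 0 le_rfl
    have p1 := hpos 1 zero_le_one
    refine ((continuousOn_const.div (h0.add continuousOn_const) fun w hw => ?_).sub
      (continuousOn_const.div (h1.add continuousOn_const) fun w hw => ?_)).add
      ((continuousOn_const.mul ((h0.sub continuousOn_const).pow 2)).div
        (((continuousOn_const.mul h0).add continuousOn_const).mul (h0.add continuousOn_const))
        fun w hw => ?_)
    · exact (add_pos_of_nonneg_of_pos (p0 w hw) one_pos).ne'
    · exact (add_pos_of_nonneg_of_pos (p1 w hw) one_pos).ne'
    · have := p0 w hw
      positivity
  have hclosed : IsClosed {w : Fin n → ℝ | ∀ j, 0 ≤ w j} := by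
    simp only [Set.ofPred_forall]
    exact isClosed_iInter fun j => isClosed_le continuous_const (continuous_apply j)
  obtain ⟨w1, hw1, hlt⟩ : ∃ w : Fin n → ℝ, (∀ j, 0 ≤ w j) ∧ Ψ w < γ / 3 := by
    have he : ∀ j : Fin n, 0 ≤ (1 : Fin n → ℝ) j := fun j => zero_le_one
    have hl0 : 0 < l (Fin.cons 0 (1 : Fin n → ℝ)) := by
      have := hlb _ (cons_nonneg le_rfl he) (Fin.succ ⟨0, hn⟩)
      rw [Fin.cons_succ] at this
      exact one_pos.trans_le this
    have hg : ContinuousOn (fun s : ℝ => l (Fin.cons s (1 : Fin n → ℝ))) (Set.Ici 0) :=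
      hcont.comp (hcons.comp (Continuous.prodMk_left 1)).continuousOn
        fun s hs => cons_nonneg hs he
    have hev := ((hg 0 Set.self_mem_Ici).mono Set.Ioi_subset_Ici_self).eventually_lt_const
      (show l (Fin.cons 0 (1 : Fin n → ℝ)) < 2 * l (Fin.cons 0 (1 : Fin n → ℝ)) by linarith)
    obtain ⟨s, hs, hs0⟩ := (hev.and self_mem_nhdsWithin).exists
    replace hs0 : 0 < s := hs0
    have hsi : 0 < s⁻¹ := inv_pos.2 hs0
    have hw : ∀ j, 0 ≤ (s⁻¹ • (1 : Fin n → ℝ)) j := fun j => mul_nonneg hsi.le (he j)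
    have e0 : l (Fin.cons 0 (s⁻¹ • (1 : Fin n → ℝ))) = s⁻¹ * l (Fin.cons 0 1) := by
      rw [← hhom _ hsi.le _ (cons_nonneg le_rfl he), smul_cons_real, mul_zero]
    have e1 : l (Fin.cons 1 (s⁻¹ • (1 : Fin n → ℝ))) = s⁻¹ * l (Fin.cons s 1) := by
      rw [← hhom _ hsi.le _ (cons_nonneg hs0.le he), smul_cons_real, inv_mul_cancel₀ hs0.ne']
    refine ⟨s⁻¹ • 1, hw, ?_⟩
    rw [hΨ]
    refine penalized_lt_limit hγ ?_ (hpos 1 zero_le_one _ hw) ?_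
    · rw [e0]
      positivity
    · rw [e0, e1, mul_left_comm]
      exact mul_lt_mul_of_pos_left hs hsi
  obtain ⟨w0, hw0, hmin⟩ := hΨc.exists_isMinOn' hclosed hw1 (by
    have hR := (tendsto_norm_cocompact_atTop (E := Fin n → ℝ)).eventually_ge_atTop
      ((2 + 3 * γ) / (γ / 3 - Ψ w1))
    filter_upwards [hR.filter_mono inf_le_left,
      Filter.mem_inf_of_right (Filter.mem_principal_self _)] with w hwR hw
    have hlow := penalized_lower_bound hγ (norm_nonneg w) (hnorm 0 le_rfl w hw)
      (hnorm 1 zero_le_one w hw)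
    rw [← hΨ w] at hlow
    have hd : 0 < γ / 3 - Ψ w1 := sub_pos.2 hlt
    have : (2 + 3 * γ) / (‖w‖ + 1) ≤ γ / 3 - Ψ w1 := by
      rw [div_le_iff₀ hd] at hwR
      rw [div_le_iff₀ (by positivity)]
      nlinarith
    linarith)
  exact ⟨w0, hw0, fun w hw => hmin hw⟩
end

section
/- Let n ≥ 2, γ > 0, and let l : [0,∞)^{n+1} → ℝ be continuous, positively homogeneous of degree 1, and satisfy max_j y_j ≤ l(y) ≤ y₀ + y₁ + … + y_n for all y = (y₀,…,y_n) ∈ [0,∞)^{n+1}. Suppose there exists a nondecreasing continuous function ζ : [0,∞) → [0,∞) such that l((1,w)) = ζ(l((0,w))) for every w ∈ [0,∞)ⁿ. Define Ψ₁(w) := 1/(l((0,w))+1) − 2/(l((1,w))+1) + (2γ/3)·(l((0,w))−1)² / ((2·l((0,w))+1)·(l((0,w))+2)). Then the set of minimizers {w ∈ [0,∞)ⁿ : Ψ₁(w) = inf_{v ∈ [0,∞)ⁿ} Ψ₁(v)} is infinite; in particular, the penalized max-stable prediction problem has infinitely many solutions. -/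
open MeasureTheory Real

/-- A level set, at a positive height, of a positively homogeneous function on the nonnegative
orthant which is positive off the origin is infinite in dimension at least two. -/
theorem infinite_level_set_of_homogeneous {n : ℕ} (hn : 2 ≤ n) (L : (Fin n → ℝ) → ℝ)
    (hhom : ∀ c : ℝ, 0 ≤ c → ∀ w : Fin n → ℝ, (∀ j, 0 ≤ w j) → L (c • w) = c * L w)
    (hlb : ∀ w : Fin n → ℝ, (∀ j, 0 ≤ w j) → ∀ j, w j ≤ L w) {t : ℝ} (ht : 0 < t) :
    {w : Fin n → ℝ | (∀ j, 0 ≤ w j) ∧ L w = t}.Infinite := by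
  let a : Fin n := ⟨0, by omega⟩
  let b : Fin n := ⟨1, by omega⟩
  have hba : b ≠ a := by simp [a, b]
  let u : ℕ → Fin n → ℝ := fun k j => if j = a then 1 else k
  have hua (k) : u k a = 1 := if_pos rfl
  have hub (k) : u k b = k := if_neg hba
  have hu (k j) : 0 ≤ u k j := by
    dsimp only [u]
    split_ifs <;> positivity
  have hL (k) : 0 < L (u k) := by
    have h := hlb (u k) (hu k) a
    rw [hua] at h
    linarith
  have hc (k) : 0 < t / L (u k) := div_pos ht (hL k)
  refine Set.infinite_of_injective_forall_mem (f := fun k => (t / L (u k)) • u k) ?_ ?_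
  · intro k m hkm
    have h1 := congrFun hkm a
    have h2 := congrFun hkm b
    simp only [Pi.smul_apply, smul_eq_mul, hua, hub, mul_one] at h1 h2
    rw [h1] at h2
    exact_mod_cast mul_left_cancel₀ (hc m).ne' h2
  · intro k
    refine ⟨fun j => mul_nonneg (hc k).le (hu k j), ?_⟩
    rw [hhom _ (hc k).le _ (hu k)]
    exact div_mul_cancel₀ _ (hL k).ne'

/-- The penalized target functional, as a function of the tail dependence value `t ∈ [0, ∞)`,
attains its minimum at a positive point. -/
theorem exists_pos_minimizer_of_penalized {γ : ℝ} (hγ : 0 < γ) {ζ : ℝ → ℝ}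
    (hζ_cont : ContinuousOn ζ (Set.Ici 0)) (hζ_lb : ∀ t, 0 ≤ t → t ≤ ζ t) (hζ_zero : ζ 0 = 1)
    (hζ_one : ζ 1 ≤ 2) :
    ∃ t : ℝ, 0 < t ∧ ∀ s : ℝ, 0 ≤ s →
      1 / (t + 1) - 2 / (ζ t + 1) + (2 * γ / 3) * (t - 1) ^ 2 / ((2 * t + 1) * (t + 2))
        ≤ 1 / (s + 1) - 2 / (ζ s + 1) + (2 * γ / 3) * (s - 1) ^ 2 / ((2 * s + 1) * (s + 2)) := by
  set g : ℝ → ℝ := fun t =>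
    1 / (t + 1) - 2 / (ζ t + 1) + (2 * γ / 3) * (t - 1) ^ 2 / ((2 * t + 1) * (t + 2)) with hg
  have hcont : ContinuousOn g (Set.Icc 0 5) := by
    have hζ' := hζ_cont.mono (Set.Icc_subset_Ici_self : Set.Icc (0 : ℝ) 5 ⊆ Set.Ici 0)
    refine ((continuousOn_const.div (by fun_prop) ?_).sub
      (continuousOn_const.div (hζ'.add continuousOn_const) ?_)).add
      (ContinuousOn.div (by fun_prop) (by fun_prop) ?_)
    · intro t ht
      linarith [ht.1]
    · intro t ht
      have : 0 < ζ t + 1 := by linarith [ht.1, hζ_lb t ht.1]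
      exact this.ne'
    · intro t ht
      have := ht.1
      positivity
  obtain ⟨t, ht, hmin⟩ := isCompact_Icc.exists_isMinOn ⟨0, by norm_num⟩ hcont
  have hg_zero : g 0 = γ / 3 := by
    simp only [hg, hζ_zero]
    ring
  have hg_one : g 1 ≤ -1 / 6 := by
    have h1 := hζ_lb 1 zero_le_one
    have h2 : 2 / 3 ≤ 2 / (ζ 1 + 1) :=
      div_le_div_of_nonneg_left zero_le_two (by linarith) (by linarith)
    simp only [hg]
    norm_num
    linarith
  have hg_far (s : ℝ) (hs : 5 ≤ s) : -1 / 6 ≤ g s := by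
    have h1 : 2 / (ζ s + 1) ≤ 2 / (s + 1) :=
      div_le_div_of_nonneg_left zero_le_two (by linarith) (by linarith [hζ_lb s (by linarith)])
    have h2 : 1 / (s + 1) ≤ 1 / 6 :=
      div_le_div_of_nonneg_left zero_le_one (by norm_num) (by linarith)
    have h3 : 2 / (s + 1) = 2 * (1 / (s + 1)) := by ring
    have h4 : 0 ≤ (2 * γ / 3) * (s - 1) ^ 2 / ((2 * s + 1) * (s + 2)) := by positivity
    simp only [hg]
    linarith
  have ht_one : g t ≤ g 1 := hmin (show (1 : ℝ) ∈ Set.Icc 0 5 by norm_num)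
  refine ⟨t, ht.1.lt_of_ne ?_, fun s hs => ?_⟩
  · rintro rfl
    linarith
  · rcases le_total s 5 with h | h
    · exact hmin ⟨hs, h⟩
    · exact ht_one.trans (hg_one.trans (hg_far s h))

theorem stmt16 {n : ℕ} (hn : 2 ≤ n) (γ : ℝ) (hγ : 0 < γ)
    (l : (Fin (n + 1) → ℝ) → ℝ)
    (hcont : ContinuousOn l {y : Fin (n + 1) → ℝ | ∀ j, 0 ≤ y j})
    (hhom : ∀ c : ℝ, 0 ≤ c → ∀ y : Fin (n + 1) → ℝ, (∀ j, 0 ≤ y j) → l (c • y) = c * l y)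
    (hlb : ∀ y : Fin (n + 1) → ℝ, (∀ j, 0 ≤ y j) → ∀ j, y j ≤ l y)
    (hub : ∀ y : Fin (n + 1) → ℝ, (∀ j, 0 ≤ y j) → l y ≤ ∑ j, y j)
    (ζ : ℝ → ℝ) (hζ_mono : MonotoneOn ζ (Set.Ici 0)) (hζ_cont : ContinuousOn ζ (Set.Ici 0))
    (hζ : ∀ w : Fin n → ℝ, (∀ j, 0 ≤ w j) → l (Fin.cons 1 w) = ζ (l (Fin.cons 0 w)))
    (Ψ : (Fin n → ℝ) → ℝ)
    (hΨ : ∀ w : Fin n → ℝ, Ψ w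
      = 1 / (l (Fin.cons 0 w) + 1) - 2 / (l (Fin.cons 1 w) + 1)
        + (2 * γ / 3) * (l (Fin.cons 0 w) - 1) ^ 2
          / ((2 * l (Fin.cons 0 w) + 1) * (l (Fin.cons 0 w) + 2))) :
    {w : Fin n → ℝ | (∀ j, 0 ≤ w j)
      ∧ ∀ v : Fin n → ℝ, (∀ j, 0 ≤ v j) → Ψ w ≤ Ψ v}.Infinite := by
  have hcons (c : ℝ) (hc : 0 ≤ c) (w : Fin n → ℝ) (hw : ∀ j, 0 ≤ w j) :
      ∀ j, 0 ≤ (Fin.cons c w : Fin (n + 1) → ℝ) j :=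
    Fin.cases hc hw
  have hL_lb (w : Fin n → ℝ) (hw : ∀ j, 0 ≤ w j) (j : Fin n) : w j ≤ l (Fin.cons 0 w) :=
    hlb _ (hcons 0 le_rfl w hw) j.succ
  let a : Fin n := ⟨0, by omega⟩
  have hsingle (t : ℝ) (ht : 0 ≤ t) : ∀ j, 0 ≤ (Pi.single a t : Fin n → ℝ) j :=
    fun j => (Pi.single_nonneg.2 ht : (0 : Fin n → ℝ) ≤ Pi.single a t) j
  have hL_single (t : ℝ) (ht : 0 ≤ t) : l (Fin.cons 0 (Pi.single a t)) = t := by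
    refine le_antisymm ?_ (by simpa using hL_lb _ (hsingle t ht) a)
    simpa [Fin.sum_univ_succ] using hub _ (hcons 0 le_rfl _ (hsingle t ht))
  have hζ_eq (t : ℝ) (ht : 0 ≤ t) : ζ t = l (Fin.cons 1 (Pi.single a t)) := by
    rw [hζ _ (hsingle t ht), hL_single t ht]
  have hζ_lb (t : ℝ) (ht : 0 ≤ t) : t ≤ ζ t := by
    rw [hζ_eq t ht]
    simpa using hlb _ (hcons 1 zero_le_one _ (hsingle t ht)) a.succ
  have hζ_ub (t : ℝ) (ht : 0 ≤ t) : ζ t ≤ 1 + t := by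
    rw [hζ_eq t ht]
    simpa [Fin.sum_univ_succ] using hub _ (hcons 1 zero_le_one _ (hsingle t ht))
  have hζ_zero : ζ 0 = 1 := by
    refine le_antisymm (by simpa using hζ_ub 0 le_rfl) ?_
    rw [hζ_eq 0 le_rfl]
    simpa using hlb _ (hcons 1 zero_le_one _ (hsingle 0 le_rfl)) 0
  obtain ⟨t, ht, hmin⟩ := exists_pos_minimizer_of_penalized hγ hζ_cont hζ_lb hζ_zero
    (by linarith [hζ_ub 1 zero_le_one])
  refine (infinite_level_set_of_homogeneous hn (fun w => l (Fin.cons 0 w)) ?_ hL_lb ht).mono ?_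
  · intro c hc w hw
    rw [← hhom c hc _ (hcons 0 le_rfl w hw)]
    congr 1
    ext j
    cases j using Fin.cases <;> simp
  · rintro w ⟨hw, hwt⟩
    refine ⟨hw, fun v hv => ?_⟩
    rw [hΨ, hΨ, hζ w hw, hζ v hv, hwt]
    exact hmin _ ((hv a).trans (hL_lb v hv a))
end
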